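/- arXiv:1202.1936 — 5 statements merged into one kernel-verified Lean document; each statement's English description precedes it below -/
import Mathlib

section
/- Let D be a probability mass function on a countable type α, let T : α → ℕ, let n ≥ 1 be a natural number, and let c ≥ 0, M ≥ 0 and ε > 0 be real numbers. Suppose that for every real t ≥ 1 we have Pr_{y∼D}[T(y) ≥ t] ≤ n^c · M / t^ε. Then, setting ε' = ε/(c+2), we have E_{y∼D}[T(y)^{ε'}] ≤ n + 2M. -/
open scoped ENNReal

open MeasureTheory Set in
/-- If the upper tail of a nonnegative random variable at `s ≥ a > 0` is at most `K * s ^ (-p)`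
with `p > 1`, then its mean is at most `a + K * a ^ (1 - p) / (p - 1)`. -/
theorem lintegral_le_of_polynomial_tail {Ω : Type*} [MeasurableSpace Ω] (μ : Measure Ω)
    [IsProbabilityMeasure μ] {f : Ω → ℝ} (hf : Measurable f) (hf0 : ∀ ω, 0 ≤ f ω)
    {a K p : ℝ} (ha : 0 < a) (hK : 0 ≤ K) (hp : 1 < p)
    (htail : ∀ s, a < s → μ {ω | s ≤ f ω} ≤ ENNReal.ofReal (K * s ^ (-p))) :
    ∫⁻ ω, ENNReal.ofReal (f ω) ∂μ ≤ ENNReal.ofReal (a + K * (a ^ (1 - p) / (p - 1))) := by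
  have hint : IntegrableOn (fun s : ℝ => K * s ^ (-p)) (Ioi a) :=
    (integrableOn_Ioi_rpow_of_lt (by linarith) ha).const_mul K
  have hval : ∫ s in Ioi a, K * s ^ (-p) = K * (a ^ (1 - p) / (p - 1)) := by
    rw [integral_const_mul, integral_Ioi_rpow_of_lt (by linarith) ha,
      show -p + 1 = -(p - 1) by ring, show 1 - p = -(p - 1) by ring, neg_div_neg_eq]
  have hnear : ∫⁻ s in Ioc 0 a, μ {ω | s ≤ f ω} ≤ ENNReal.ofReal a :=
    calc ∫⁻ s in Ioc 0 a, μ {ω | s ≤ f ω} ≤ ∫⁻ _ in Ioc 0 a, 1 :=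
          lintegral_mono fun _ => prob_le_one
      _ = ENNReal.ofReal a := by simp
  have hfar : ∫⁻ s in Ioi a, μ {ω | s ≤ f ω} ≤ ENNReal.ofReal (K * (a ^ (1 - p) / (p - 1))) :=
    calc ∫⁻ s in Ioi a, μ {ω | s ≤ f ω} ≤ ∫⁻ s in Ioi a, ENNReal.ofReal (K * s ^ (-p)) :=
          setLIntegral_mono' measurableSet_Ioi htail
      _ = ENNReal.ofReal (K * (a ^ (1 - p) / (p - 1))) := by
          rw [← hval, ofReal_integral_eq_lintegral_ofReal hint]
          filter_upwards [ae_restrict_mem measurableSet_Ioi] with s hs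
          have : 0 < s := ha.trans hs
          positivity
  have hnonneg : 0 ≤ K * (a ^ (1 - p) / (p - 1)) :=
    mul_nonneg hK (div_nonneg (by positivity) (by linarith))
  rw [lintegral_eq_lintegral_meas_le μ (Filter.Eventually.of_forall hf0) hf.aemeasurable,
    ← Ioc_union_Ioi_eq_Ioi ha.le,
    lintegral_union measurableSet_Ioi (Ioc_disjoint_Ioi le_rfl), ENNReal.ofReal_add ha.le hnonneg]
  exact add_le_add hnear hfar

/-- If the running time `T` has polynomially decreasing tails,
`Pr_{y∼D}[T(y) ≥ t] ≤ n^c · M / t^ε` for all `t ≥ 1`, then with `ε' = ε/(c+2)`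
the moment `E_{y∼D}[T(y)^{ε'}]` is at most `n + 2M`. -/
theorem smoothed_moment_of_tail {α : Type*} [Countable α] (D : PMF α) (T : α → ℕ)
    (n : ℕ) (hn : 1 ≤ n) (c M ε : ℝ) (hc : 0 ≤ c) (hM : 0 ≤ M) (hε : 0 < ε)
    (hTail : ∀ t : ℝ, 1 ≤ t →
      ∑' y : {y : α // t ≤ (T y : ℝ)}, D y ≤ ENNReal.ofReal ((n : ℝ) ^ c * M / t ^ ε)) :
    ∑' y, D y * (T y : ℝ≥0∞) ^ (ε / (c + 2)) ≤ ENNReal.ofReal ((n : ℝ) + 2 * M) := by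
  let _ : MeasurableSpace α := ⊤
  have hn1 : (1 : ℝ) ≤ n := by exact_mod_cast hn
  have hn0 : (0 : ℝ) < n := by linarith
  have hc2 : 0 < c + 2 := by linarith
  have hε' : 0 < ε / (c + 2) := by positivity
  have hmoment : ∑' y, D y * (T y : ℝ≥0∞) ^ (ε / (c + 2)) =
      ∫⁻ y, ENNReal.ofReal ((T y : ℝ) ^ (ε / (c + 2))) ∂D.toMeasure := by
    rw [MeasureTheory.lintegral_countable']
    refine tsum_congr fun y => ?_
    rw [D.toMeasure_apply_singleton y (MeasurableSet.singleton y), mul_comm,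
      ← ENNReal.ofReal_rpow_of_nonneg (Nat.cast_nonneg _) hε'.le, ENNReal.ofReal_natCast]
  have htail : ∀ s : ℝ, (n : ℝ) < s → D.toMeasure {y | s ≤ (T y : ℝ) ^ (ε / (c + 2))} ≤
      ENNReal.ofReal ((n : ℝ) ^ c * M * s ^ (-(c + 2))) := by
    intro s hs
    have hs0 : 0 < s := hn0.trans hs
    have hset : {y | s ≤ (T y : ℝ) ^ (ε / (c + 2))} =
        {y | s ^ (ε / (c + 2))⁻¹ ≤ (T y : ℝ)} := by
      ext y
      exact (Real.rpow_inv_le_iff_of_pos hs0.le (Nat.cast_nonneg _) hε').symm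
    have hpow : (s ^ (ε / (c + 2))⁻¹) ^ ε = s ^ (c + 2) := by
      rw [← Real.rpow_mul hs0.le]
      congr 1
      field_simp
    have h := hTail (s ^ (ε / (c + 2))⁻¹)
      (Real.one_le_rpow (hn1.trans hs.le) (inv_nonneg.2 hε'.le))
    rw [hpow, div_eq_mul_inv (_ * M), ← Real.rpow_neg hs0.le] at h
    rw [hset, D.toMeasure_apply MeasurableSpace.measurableSet_top, ← tsum_subtype]
    exact h
  rw [hmoment]
  refine (lintegral_le_of_polynomial_tail D.toMeasure measurable_from_top
    (fun y => by positivity) hn0 (by positivity) (by linarith) htail).trans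
    (ENNReal.ofReal_le_ofReal ?_)
  have hcancel : (n : ℝ) ^ c * (n : ℝ) ^ (1 - (c + 2)) = (n : ℝ)⁻¹ := by
    rw [← Real.rpow_add hn0, ← Real.rpow_neg_one]
    congr 1
    ring
  have hbound : (n : ℝ)⁻¹ / (c + 2 - 1) ≤ 1 :=
    div_le_one_of_le₀ ((inv_le_one_of_one_le₀ hn1).trans (by linarith)) (by linarith)
  calc (n : ℝ) + (n : ℝ) ^ c * M * ((n : ℝ) ^ (1 - (c + 2)) / (c + 2 - 1))
      = n + M * ((n : ℝ)⁻¹ / (c + 2 - 1)) := by rw [← hcancel]; ring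
    _ ≤ n + M * 1 := by gcongr
    _ ≤ n + 2 * M := by linarith
end

section
/- For every weight vector w ∈ ℕ^n and all t, δ ∈ ℕ with δ ≤ t, the following are equivalent: (a) the winner x*(t) exists and Γ(t) < δ; (b) the loser x̂(t−δ) exists and Λ(t−δ) ≤ δ. Consequently, if the weight vector w is drawn according to any probability distribution on ℕ^n, then Pr(Γ(t) < δ) = Pr(Λ(t−δ) ≤ δ), where Γ(t) < δ abbreviates the event (a) and Λ(t−δ) ≤ δ abbreviates the event (b). -/
open scoped ENNReal

/-- `wdot w x = wᵀx` for a weight vector `w ∈ ℕⁿ` and a 0/1 solution vector `x`. -/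
def wdot {n : ℕ} (w : Fin n → ℕ) (x : Fin n → Bool) : ℕ :=
  ∑ i, w i * (x i).toNat

/-- A ranking is monotone if `x ≻ y` implies `xᵢ = 1` and `yᵢ = 0` for some `i`. -/
def MonotoneRanking {n : ℕ} (succ : (Fin n → Bool) → (Fin n → Bool) → Prop) : Prop :=
  ∀ x y, succ x y → ∃ i, x i = true ∧ y i = false

/-- The winner `x*(t)`: the `≻`-largest solution in `S` with `wᵀx ≤ t`. -/
def IsWinner {n : ℕ} (S : Set (Fin n → Bool))
    (succ : (Fin n → Bool) → (Fin n → Bool) → Prop)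
    (w : Fin n → ℕ) (t : ℕ) (xs : Fin n → Bool) : Prop :=
  xs ∈ S ∧ wdot w xs ≤ t ∧
    ∀ y ∈ S, wdot w y ≤ t → y ≠ xs → succ xs y

/-- The solutions ranked above the winner (all of `S` if no winner exists). -/
def AboveWinner {n : ℕ} (S : Set (Fin n → Bool))
    (succ : (Fin n → Bool) → (Fin n → Bool) → Prop)
    (w : Fin n → ℕ) (t : ℕ) : Set (Fin n → Bool) :=
  {x | x ∈ S ∧ ∀ xs, IsWinner S succ w t xs → succ x xs}

/-- The loser `x̂(t)`: it minimizes `wᵀx` among all solutions ranked above the winner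
(among all solutions in `S` if no winner exists), ties broken in favour of the
`≻`-largest minimizer. -/
def IsLoser {n : ℕ} (S : Set (Fin n → Bool))
    (succ : (Fin n → Bool) → (Fin n → Bool) → Prop)
    (w : Fin n → ℕ) (t : ℕ) (xh : Fin n → Bool) : Prop :=
  xh ∈ AboveWinner S succ w t ∧
    (∀ y ∈ AboveWinner S succ w t, wdot w xh ≤ wdot w y) ∧
    ∀ y ∈ AboveWinner S succ w t, wdot w y = wdot w xh → y ≠ xh → succ xh y

/-- The event `Γ(t) < δ`: the winner exists and its winner gap is less than `δ`. -/
def GammaLt {n : ℕ} (S : Set (Fin n → Bool))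
    (succ : (Fin n → Bool) → (Fin n → Bool) → Prop)
    (w : Fin n → ℕ) (t δ : ℕ) : Prop :=
  ∃ xs, IsWinner S succ w t xs ∧ t - wdot w xs < δ

/-- The event `Λ(t) ≤ δ`: the loser exists and its loser gap is at most `δ`. -/
def LambdaLe {n : ℕ} (S : Set (Fin n → Bool))
    (succ : (Fin n → Bool) → (Fin n → Bool) → Prop)
    (w : Fin n → ℕ) (t δ : ℕ) : Prop :=
  ∃ xh, IsLoser S succ w t xh ∧ wdot w xh - t ≤ δ

/-- A nonempty set of solutions has a largest element with respect to a strict linear order. -/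
theorem exists_ranking_greatest {n : ℕ} {succ : (Fin n → Bool) → (Fin n → Bool) → Prop}
    (hsto : IsStrictTotalOrder (Fin n → Bool) succ) {A : Set (Fin n → Bool)}
    (hA : A.Nonempty) : ∃ m ∈ A, ∀ y ∈ A, y ≠ m → succ m y := by
  have hwf : WellFounded succ := Finite.wellFounded_of_trans_of_irrefl succ
  obtain ⟨m, hm, hmin⟩ := hwf.has_min A hA
  refine ⟨m, hm, fun y hy hne => ?_⟩
  rcases trichotomous_of succ m y with h | h | h
  · exact h
  · exact absurd h.symm hne
  · exact absurd h (hmin y hy)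

theorem exists_isWinner {n : ℕ} {S : Set (Fin n → Bool)}
    {succ : (Fin n → Bool) → (Fin n → Bool) → Prop}
    (hsto : IsStrictTotalOrder (Fin n → Bool) succ) {w : Fin n → ℕ} {t : ℕ}
    {x : Fin n → Bool} (hx : x ∈ S) (hxt : wdot w x ≤ t) :
    ∃ xs, IsWinner S succ w t xs := by
  obtain ⟨m, ⟨hmS, hmt⟩, hm⟩ :=
    exists_ranking_greatest hsto (A := {y | y ∈ S ∧ wdot w y ≤ t}) ⟨x, hx, hxt⟩
  exact ⟨m, hmS, hmt, fun y hy hyt => hm y ⟨hy, hyt⟩⟩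

theorem exists_isLoser {n : ℕ} {S : Set (Fin n → Bool)}
    {succ : (Fin n → Bool) → (Fin n → Bool) → Prop}
    (hsto : IsStrictTotalOrder (Fin n → Bool) succ) {w : Fin n → ℕ} {t : ℕ}
    (h : (AboveWinner S succ w t).Nonempty) :
    ∃ xh, IsLoser S succ w t xh := by
  obtain ⟨a, ha, hmin⟩ :=
    Set.exists_min_image (AboveWinner S succ w t) (wdot w) (Set.toFinite _) h
  obtain ⟨m, ⟨hmA, hmw⟩, hm⟩ := exists_ranking_greatest hsto
    (A := {y | y ∈ AboveWinner S succ w t ∧ wdot w y = wdot w a}) ⟨a, ha, rfl⟩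
  exact ⟨m, hmA, fun y hy => hmw.le.trans (hmin y hy),
    fun y hy hyw => hm y ⟨hy, hyw.trans hmw⟩⟩

/-- A feasible solution is not ranked above the winner. -/
theorem IsWinner.not_succ {n : ℕ} {S : Set (Fin n → Bool)}
    {succ : (Fin n → Bool) → (Fin n → Bool) → Prop}
    (hsto : IsStrictTotalOrder (Fin n → Bool) succ) {w : Fin n → ℕ} {t : ℕ}
    {xs x : Fin n → Bool} (hxs : IsWinner S succ w t xs) (hx : x ∈ S)
    (hxt : wdot w x ≤ t) : ¬ succ x xs := by
  intro h
  by_cases hne : x = xs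
  · exact irrefl_of succ xs (hne ▸ h)
  · exact asymm_of succ h (hxs.2.2 x hx hxt hne)

/-- Solutions ranked above the winner exceed the threshold. -/
theorem lt_wdot_of_mem_aboveWinner {n : ℕ} {S : Set (Fin n → Bool)}
    {succ : (Fin n → Bool) → (Fin n → Bool) → Prop}
    (hsto : IsStrictTotalOrder (Fin n → Bool) succ) {w : Fin n → ℕ} {t : ℕ}
    {x : Fin n → Bool} (hx : x ∈ AboveWinner S succ w t) : t < wdot w x := by
  by_contra! hxt
  obtain ⟨xs, hxs⟩ := exists_isWinner hsto hx.1 hxt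
  exact hxs.not_succ hsto hx.1 hxt (hx.2 xs hxs)

theorem gammaLt_iff_lambdaLe {n : ℕ} {S : Set (Fin n → Bool)}
    {succ : (Fin n → Bool) → (Fin n → Bool) → Prop}
    (hsto : IsStrictTotalOrder (Fin n → Bool) succ) {t δ : ℕ} (hδt : δ ≤ t)
    (w : Fin n → ℕ) : GammaLt S succ w t δ ↔ LambdaLe S succ w (t - δ) δ := by
  constructor
  · rintro ⟨xs, hxs, hgap⟩
    have hxst := hxs.2.1
    have hmem : xs ∈ AboveWinner S succ w (t - δ) := by
      refine ⟨hxs.1, fun y hy => hxs.2.2 y hy.1 (hy.2.1.trans (Nat.sub_le t δ)) ?_⟩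
      rintro rfl
      have := hy.2.1
      omega
    obtain ⟨xh, hxh⟩ := exists_isLoser hsto ⟨xs, hmem⟩
    have := hxh.2.1 xs hmem
    exact ⟨xh, hxh, by omega⟩
  · rintro ⟨xh, hxh, hgap⟩
    have hxhS := hxh.1.1
    have hxht : wdot w xh ≤ t := by omega
    have hlt := lt_wdot_of_mem_aboveWinner hsto hxh.1
    obtain ⟨xs, hxs⟩ := exists_isWinner hsto hxhS hxht
    have hxst := hxs.2.1
    have hgt : t - δ < wdot w xs := by
      by_contra! hle
      have hwin : IsWinner S succ w (t - δ) xs :=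
        ⟨hxs.1, hle, fun y hy hyt => hxs.2.2 y hy (hyt.trans (Nat.sub_le t δ))⟩
      exact hxs.not_succ hsto hxhS hxht (hxh.1.2 xs hwin)
    exact ⟨xs, hxs, by omega⟩

/-- The paper's Lemma 3: for `δ ≤ t` the events `Γ(t) < δ` and `Λ(t−δ) ≤ δ` coincide
for every weight vector; consequently `Pr(Γ(t) < δ) = Pr(Λ(t−δ) ≤ δ)` for every
distribution on weight vectors. -/
theorem gamma_lambda_gap {n : ℕ} (S : Set (Fin n → Bool))
    (succ : (Fin n → Bool) → (Fin n → Bool) → Prop)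
    (hsto : IsStrictTotalOrder (Fin n → Bool) succ)
    (hmono : MonotoneRanking succ)
    (h0 : (fun _ => false) ∉ S)
    (t δ : ℕ) (hδt : δ ≤ t) :
    (∀ w : Fin n → ℕ, GammaLt S succ w t δ ↔ LambdaLe S succ w (t - δ) δ) ∧
    ∀ D : PMF (Fin n → ℕ),
      ∑' w : {w : Fin n → ℕ | GammaLt S succ w t δ}, D w =
        ∑' w : {w : Fin n → ℕ | LambdaLe S succ w (t - δ) δ}, D w := by
  have h := gammaLt_iff_lambdaLe (S := S) hsto hδt
  refine ⟨h, fun D => ?_⟩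
  have hset : {w | GammaLt S succ w t δ} = {w | LambdaLe S succ w (t - δ) δ} := Set.ext h
  rw [hset]
end

section
/- Suppose the weight vector w is random: w_1, …, w_n are independent ℕ-valued random variables, each taking values in {0, 1, …, 2^n − 1}, and each attaining any single value with probability at most p. Then for every t, δ ∈ ℕ: the probability that the winner x*(t) exists and Γ(t) < δ is at most δ·p·n, and the probability that the loser x̂(t) exists and Λ(t) ≤ δ is at most δ·p·n. -/
open scoped ENNReal

/-- `w` has a solution of weight at most `U` that is ranked above every solution of weight at most
`U - δ`. -/
def NearThreshold {n : ℕ} (S : Set (Fin n → Bool))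
    (succ : (Fin n → Bool) → (Fin n → Bool) → Prop) (U δ : ℕ) (w : Fin n → ℕ) : Prop :=
  ∃ x ∈ S, wdot w x ≤ U ∧ ∀ y ∈ S, wdot w y + δ ≤ U → succ x y

/-- The solutions containing item `i` that are ranked above every solution of weight at most
`U - δ` without item `i`. This set does not depend on `w i`. -/
def AboveWithout {n : ℕ} (S : Set (Fin n → Bool))
    (succ : (Fin n → Bool) → (Fin n → Bool) → Prop) (U δ : ℕ) (i : Fin n) (w : Fin n → ℕ) :
    Set (Fin n → Bool) :=
  {x | x ∈ S ∧ x i = true ∧ ∀ y ∈ S, y i = false → wdot w y + δ ≤ U → succ x y}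

/-- The smallest weight in `AboveWithout S succ U δ i w` lies in `(U - δ, U]`. -/
def NearThresholdAt {n : ℕ} (S : Set (Fin n → Bool))
    (succ : (Fin n → Bool) → (Fin n → Bool) → Prop) (U δ : ℕ) (i : Fin n) (w : Fin n → ℕ) : Prop :=
  (∀ x ∈ AboveWithout S succ U δ i w, U < wdot w x + δ) ∧
    ∃ x ∈ AboveWithout S succ U δ i w, wdot w x ≤ U

theorem exists_top {α : Type*} [Finite α] {r : α → α → Prop} (hr : IsStrictTotalOrder α r)
    {s : Set α} (hs : s.Nonempty) : ∃ m ∈ s, ∀ y ∈ s, y ≠ m → r m y := by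
  have hwf : WellFounded r := Finite.wellFounded_of_trans_of_irrefl r
  obtain ⟨m, hm, h⟩ := hwf.has_min s hs
  refine ⟨m, hm, fun y hy hne => ?_⟩
  rcases trichotomous_of r m y with h1 | h1 | h1
  · exact h1
  · exact absurd h1.symm hne
  · exact absurd h1 (h y hy)

theorem wdot_eq_add_sum {n : ℕ} (w : Fin n → ℕ) (i : Fin n) (x : Fin n → Bool) :
    wdot w x = w i * (x i).toNat + ∑ j ∈ Finset.univ.erase i, w j * (x j).toNat :=
  (Finset.add_sum_erase _ _ (Finset.mem_univ i)).symm

theorem wdot_update {n : ℕ} (w : Fin n → ℕ) (i : Fin n) (a : ℕ) (x : Fin n → Bool) :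
    wdot (Function.update w i a) x =
      a * (x i).toNat + ∑ j ∈ Finset.univ.erase i, w j * (x j).toNat := by
  rw [wdot_eq_add_sum _ i, Function.update_self]
  congr 1
  refine Finset.sum_congr rfl fun j hj => ?_
  rw [Function.update_of_ne (Finset.ne_of_mem_erase hj)]

theorem aboveWithout_update {n : ℕ} (S : Set (Fin n → Bool))
    (succ : (Fin n → Bool) → (Fin n → Bool) → Prop) (U δ : ℕ) (i : Fin n) (w : Fin n → ℕ)
    (a b : ℕ) : AboveWithout S succ U δ i (Function.update w i a) =
      AboveWithout S succ U δ i (Function.update w i b) := by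
  ext x
  simp +contextual only [AboveWithout, Set.mem_ofPred_eq, wdot_update, Bool.toNat_false, mul_zero]

theorem lt_add_of_nearThresholdAt_update {n : ℕ} {S : Set (Fin n → Bool)}
    {succ : (Fin n → Bool) → (Fin n → Bool) → Prop} {U δ : ℕ} {i : Fin n} {w : Fin n → ℕ}
    {a b : ℕ} (ha : NearThresholdAt S succ U δ i (Function.update w i a))
    (hb : NearThresholdAt S succ U δ i (Function.update w i b)) : a < b + δ := by
  obtain ⟨x, hx, hxU⟩ := ha.2
  rw [aboveWithout_update S succ U δ i w a b] at hx
  have h := hb.1 x hx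
  simp only [wdot_update, hx.2.1, Bool.toNat_true, mul_one] at h hxU
  omega

theorem NearThreshold.exists_at {n : ℕ} {S : Set (Fin n → Bool)}
    {succ : (Fin n → Bool) → (Fin n → Bool) → Prop} (hsto : IsStrictTotalOrder (Fin n → Bool) succ)
    (hmono : MonotoneRanking succ) (h0 : (fun _ => false) ∉ S) {U δ : ℕ} {w : Fin n → ℕ}
    (h : NearThreshold S succ U δ w) : ∃ i, NearThresholdAt S succ U δ i w := by
  obtain ⟨x, hxS, hxU, hx⟩ := h
  rcases Set.eq_empty_or_nonempty {y | y ∈ S ∧ wdot w y + δ ≤ U} with he | hne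
  · obtain ⟨i, hi⟩ : ∃ i, x i = true := by
      by_contra! hcon
      exact h0 (by simpa [funext fun i => Bool.eq_false_of_not_eq_true (hcon i)] using hxS)
    refine ⟨i, fun z hz => ?_, x, ⟨hxS, hi, fun y hy _ => hx y hy⟩, hxU⟩
    by_contra! hz'
    exact (Set.eq_empty_iff_forall_notMem.1 he) z ⟨hz.1, hz'⟩
  · obtain ⟨m, ⟨hmS, hmU⟩, hm⟩ := exists_top hsto hne
    obtain ⟨i, hi, hmi⟩ := hmono _ _ (hx m hmS hmU)
    refine ⟨i, fun z hz => ?_, x, ⟨hxS, hi, fun y hy _ => hx y hy⟩, hxU⟩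
    by_contra! hz'
    have hzm := hz.2.2 m hmS hmi hmU
    have hne : z ≠ m := by
      rintro rfl
      exact irrefl_of succ _ hzm
    exact asymm_of succ hzm (hm z ⟨hz.1, hz'⟩ hne)

theorem IsWinner.nearThreshold {n : ℕ} {S : Set (Fin n → Bool)}
    {succ : (Fin n → Bool) → (Fin n → Bool) → Prop} {w : Fin n → ℕ} {t δ : ℕ} {xs : Fin n → Bool}
    (h : IsWinner S succ w t xs) (hδ : t - wdot w xs < δ) : NearThreshold S succ t δ w := by
  obtain ⟨hS, ht, hw⟩ := h
  refine ⟨xs, hS, ht, fun y hy hyt => hw y hy (by omega) ?_⟩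
  rintro rfl
  omega

theorem IsLoser.nearThreshold {n : ℕ} {S : Set (Fin n → Bool)}
    {succ : (Fin n → Bool) → (Fin n → Bool) → Prop} (hsto : IsStrictTotalOrder (Fin n → Bool) succ)
    {w : Fin n → ℕ} {t δ : ℕ} {xh : Fin n → Bool}
    (h : IsLoser S succ w t xh) (hδ : wdot w xh - t ≤ δ) :
    NearThreshold S succ (t + δ) δ w := by
  obtain ⟨⟨hS, habove⟩, -, -⟩ := h
  refine ⟨xh, hS, by omega, fun y hy hyt => ?_⟩
  have hyt : wdot w y ≤ t := by omega
  obtain ⟨m, ⟨hmS, hmt⟩, hm⟩ := exists_top hsto (s := {y | y ∈ S ∧ wdot w y ≤ t}) ⟨y, hy, hyt⟩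
  have hxm := habove m ⟨hmS, hmt, fun z hz hzt => hm z ⟨hz, hzt⟩⟩
  by_cases hym : y = m
  · rwa [hym]
  · exact trans_of succ hxm (hm y ⟨hy, hyt⟩ hym)

theorem tsum_prod_pmf_eq_one {ι α : Type*} [Fintype ι] [Countable α] (D : ι → PMF α) :
    ∑' g : ι → α, ∏ i, D i (g i) = 1 := by
  let _ : MeasurableSpace α := ⊤
  have : MeasurableSingletonClass α := ⟨fun _ => trivial⟩
  let μ := MeasureTheory.Measure.pi fun i => (D i).toMeasure
  have h : ∀ g : ι → α, ∏ i, D i (g i) = μ {g} := fun g => by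
    simp [μ, MeasureTheory.Measure.pi_singleton, PMF.toMeasure_apply_singleton]
  simp_rw [h]
  have := MeasureTheory.Measure.tsum_indicator_apply_singleton μ Set.univ MeasurableSet.univ
  simpa using this

theorem tsum_indicator_le_of_lt_add {f : ℕ → ℝ≥0∞} {P : ℝ≥0∞} (hf : ∀ a, f a ≤ P) {s : Set ℕ}
    {δ : ℕ} (hs : ∀ a ∈ s, ∀ b ∈ s, a < b + δ) : ∑' a, s.indicator f a ≤ δ * P := by
  rcases s.eq_empty_or_nonempty with rfl | hne
  · simp
  have hm := Nat.sInf_mem hne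
  calc ∑' a, s.indicator f a
      = ∑ a ∈ Finset.Ico (sInf s) (sInf s + δ), s.indicator f a := by
        refine tsum_eq_sum fun a ha => Set.indicator_of_notMem (fun has => ha ?_) f
        exact Finset.mem_Ico.2 ⟨Nat.sInf_le has, hs a has _ hm⟩
    _ ≤ ∑ a ∈ Finset.Ico (sInf s) (sInf s + δ), P :=
        Finset.sum_le_sum fun a _ => (Set.indicator_le_self s f a).trans (hf a)
    _ = δ * P := by simp

theorem tsum_indicator_prod_le {ι : Type*} [Fintype ι] [DecidableEq ι] (D : ι → PMF ℕ) {P : ℝ≥0∞}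
    (i : ι) (hD : ∀ a, D i a ≤ P) {E : Set (ι → ℕ)} {δ : ℕ}
    (hE : ∀ w a b, Function.update w i a ∈ E → Function.update w i b ∈ E → a < b + δ) :
    ∑' w, E.indicator (fun w => ∏ j, D j (w j)) w ≤ δ * P := by
  let e := Equiv.funSplitAt i ℕ
  have key : ∀ (g : {j // j ≠ i} → ℕ) (a : ℕ),
      E.indicator (fun w => ∏ j, D j (w j)) (e.symm (a, g)) =
        {a | e.symm (a, g) ∈ E}.indicator (D i) a * ∏ j : {j // j ≠ i}, D j (g j) := by
    intro g a
    have hi : e.symm (a, g) i = a := by simp [e]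
    have hj : ∀ j : {j // j ≠ i}, e.symm (a, g) j = g j := fun j => by simp [e, j.2]
    by_cases h : e.symm (a, g) ∈ E
    · rw [Set.indicator_of_mem h, Set.indicator_of_mem (show a ∈ {a | e.symm (a, g) ∈ E} from h),
        ← Finset.mul_prod_erase _ _ (Finset.mem_univ i), hi]
      congr 1
      rw [Finset.prod_subtype (p := fun j => j ≠ i) _ (by simp)]
      exact Finset.prod_congr rfl fun j _ => by rw [hj]
    · rw [Set.indicator_of_notMem h,
        Set.indicator_of_notMem (show a ∉ {a | e.symm (a, g) ∈ E} from h), zero_mul]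
  have upd : ∀ (g : {j // j ≠ i} → ℕ) (a : ℕ),
      e.symm (a, g) = Function.update (e.symm (0, g)) i a := by
    intro g a
    ext j
    by_cases h : j = i
    · subst h; simp [e]
    · simp [e, h]
  rw [← e.symm.tsum_eq, ENNReal.tsum_prod', ENNReal.tsum_comm]
  simp_rw [key, ENNReal.tsum_mul_right]
  calc _ ≤ ∑' g : {j // j ≠ i} → ℕ, δ * P * ∏ j : {j // j ≠ i}, D j (g j) := by
        refine ENNReal.tsum_le_tsum fun g => mul_le_mul_left ?_ _
        refine tsum_indicator_le_of_lt_add hD fun a ha b hb => hE (e.symm (0, g)) a b ?_ ?_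
        · rw [← upd]; exact ha
        · rw [← upd]; exact hb
    _ = δ * P := by
        rw [ENNReal.tsum_mul_left, tsum_prod_pmf_eq_one fun j : {j // j ≠ i} => D j, mul_one]

theorem tsum_subset_nearThreshold_le {n : ℕ} {S : Set (Fin n → Bool)}
    {succ : (Fin n → Bool) → (Fin n → Bool) → Prop} (hsto : IsStrictTotalOrder (Fin n → Bool) succ)
    (hmono : MonotoneRanking succ) (h0 : (fun _ => false) ∉ S)
    (D : Fin n → PMF ℕ) {P : ℝ≥0∞} (hD : ∀ i k, D i k ≤ P) {U δ : ℕ} {E : Set (Fin n → ℕ)}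
    (hE : ∀ w ∈ E, NearThreshold S succ U δ w) :
    ∑' w : E, ∏ i, D i (w.1 i) ≤ n * (δ * P) := by
  rw [tsum_subtype E fun w => ∏ i, D i (w i)]
  calc ∑' w, E.indicator (fun w => ∏ i, D i (w i)) w
      ≤ ∑' w, ∑ i, {w | NearThresholdAt S succ U δ i w}.indicator (fun w => ∏ j, D j (w j)) w := by
        refine ENNReal.tsum_le_tsum fun w => ?_
        by_cases hw : w ∈ E
        · obtain ⟨i, hi⟩ := (hE w hw).exists_at hsto hmono h0
          have hi' : w ∈ {w | NearThresholdAt S succ U δ i w} := hi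
          rw [Set.indicator_of_mem hw, ← Set.indicator_of_mem hi' fun w => ∏ j, D j (w j)]
          exact Finset.single_le_sum
            (f := fun i => {w | NearThresholdAt S succ U δ i w}.indicator
              (fun w => ∏ j, D j (w j)) w) (fun _ _ => zero_le) (Finset.mem_univ i)
        · simp [Set.indicator_of_notMem hw]
    _ = ∑ i, ∑' w, {w | NearThresholdAt S succ U δ i w}.indicator (fun w => ∏ j, D j (w j)) w :=
        Summable.tsum_finsetSum fun _ _ => ENNReal.summable
    _ ≤ ∑ _i : Fin n, δ * P := Finset.sum_le_sum fun i _ =>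
        tsum_indicator_prod_le D i (hD i) fun _ _ _ => lt_add_of_nearThresholdAt_update
    _ = n * (δ * P) := by simp

/-- The paper's separating lemma (Lemma 4), monotone-ranking case: if the coordinates
`w₁, …, wₙ` are independent, take values in `{0, …, 2ⁿ − 1}`, and each point mass is at
most `p`, then `Pr(Γ(t) < δ) ≤ δ·p·n` and `Pr(Λ(t) ≤ δ) ≤ δ·p·n`.
The joint distribution of `w` is the product `w ↦ ∏ i, Dᵢ (w i)`. -/
theorem separating_lemma {n : ℕ} (S : Set (Fin n → Bool))
    (succ : (Fin n → Bool) → (Fin n → Bool) → Prop)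
    (hsto : IsStrictTotalOrder (Fin n → Bool) succ)
    (hmono : MonotoneRanking succ)
    (h0 : (fun _ => false) ∉ S)
    (D : Fin n → PMF ℕ) (p : ℝ) (hp : 0 ≤ p)
    (hbound : ∀ i k, D i k ≤ ENNReal.ofReal p)
    (hrange : ∀ i k, 0 < D i k → k < 2 ^ n)
    (t δ : ℕ) :
    (∑' w : {w : Fin n → ℕ | ∃ xs, IsWinner S succ w t xs ∧ t - wdot w xs < δ},
        ∏ i, D i (w.1 i)) ≤ ENNReal.ofReal (δ * p * n) ∧
    (∑' w : {w : Fin n → ℕ | ∃ xh, IsLoser S succ w t xh ∧ wdot w xh - t ≤ δ},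
        ∏ i, D i (w.1 i)) ≤ ENNReal.ofReal (δ * p * n) := by
  have hP : ENNReal.ofReal (δ * p * n) = n * (δ * ENNReal.ofReal p) := by
    rw [ENNReal.ofReal_mul (by positivity), ENNReal.ofReal_mul (by positivity),
      ENNReal.ofReal_natCast, ENNReal.ofReal_natCast, mul_comm]
  rw [hP]
  exact ⟨tsum_subset_nearThreshold_le hsto hmono h0 D hbound
      fun _ ⟨_, hxs, hgap⟩ => hxs.nearThreshold hgap,
    tsum_subset_nearThreshold_le hsto hmono h0 D hbound
      fun _ ⟨_, hxh, hgap⟩ => hxh.nearThreshold hsto hgap⟩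
end

section
/- Fix i ∈ {1,…,n}, a threshold t ∈ ℕ, and fixed values w_j ∈ ℕ for all j ≠ i; only the coordinate w_i is random, attaining any single value in ℕ with probability at most p. Let S̄_i = {x ∈ S : x_i = 0} and S_i = {x ∈ S : x_i = 1}. Let x*ⁱ be the ≻-largest x ∈ S̄_i with wᵀx ≤ t (this is determined by the w_j with j ≠ i, since x_i = 0 for x ∈ S̄_i), and let R = {x ∈ S_i : x ≻ x*ⁱ} (with R = S_i if no such x*ⁱ exists). If R is nonempty, let x̂ⁱ ∈ R minimize Σ_{j≠i} w_j x_j over R (again determined by the w_j with j ≠ i), and set Λ_i = wᵀx̂ⁱ − t = w_i + Σ_{j≠i} w_j x̂ⁱ_j − t, viewed as an integer. Then for every δ ∈ ℕ, the probability over w_i that 1 ≤ Λ_i ≤ δ is at most δ·p. -/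
open scoped ENNReal

/-- `partialDot i w x = Σ_{j≠i} w_j x_j`. -/
def partialDot {n : ℕ} (i : Fin n) (w : Fin n → ℕ) (x : Fin n → Bool) : ℕ :=
  ∑ j, if j = i then 0 else w j * (x j).toNat

/-- `x*ⁱ`: the `≻`-largest `x ∈ S̄ᵢ = {x ∈ S : xᵢ = 0}` with `wᵀx ≤ t`; for such `x`
one has `wᵀx = Σ_{j≠i} w_j x_j`, so this is determined by the `w_j` with `j ≠ i`. -/
def IsWinnerBar {n : ℕ} (S : Set (Fin n → Bool))
    (succ : (Fin n → Bool) → (Fin n → Bool) → Prop)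
    (i : Fin n) (w : Fin n → ℕ) (t : ℕ) (xs : Fin n → Bool) : Prop :=
  xs ∈ S ∧ xs i = false ∧ partialDot i w xs ≤ t ∧
    ∀ y ∈ S, y i = false → partialDot i w y ≤ t → y ≠ xs → succ xs y

/-- `R = {x ∈ Sᵢ : x ≻ x*ⁱ}`, with `R = Sᵢ = {x ∈ S : xᵢ = 1}` if no `x*ⁱ` exists. -/
def AboveWinnerBar {n : ℕ} (S : Set (Fin n → Bool))
    (succ : (Fin n → Bool) → (Fin n → Bool) → Prop)
    (i : Fin n) (w : Fin n → ℕ) (t : ℕ) : Set (Fin n → Bool) :=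
  {x | x ∈ S ∧ x i = true ∧ ∀ xs, IsWinnerBar S succ i w t xs → succ x xs}

/-- A sum over a subset of a finset is at most the size of the finset times a pointwise bound. -/
theorem ENNReal.tsum_subtype_le_card_mul {α : Type*} {f : α → ℝ≥0∞} {C : ℝ≥0∞} {s : Set α}
    {F : Finset α} (hs : s ⊆ F) (hf : ∀ a, f a ≤ C) :
    ∑' a : s, f a ≤ F.card * C :=
  calc ∑' a : s, f a ≤ ∑' a : (F : Set α), f a := ENNReal.tsum_mono_subtype f hs
    _ = ∑ a ∈ F, f a := F.tsum_subtype' f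
    _ ≤ F.card * C := by
      simpa only [nsmul_eq_mul] using F.sum_le_card_nsmul f C fun a _ => hf a

/-- Per-coordinate estimate from the proof of the paper's separating lemma (Lemma 4):
with all coordinates `w_j` (`j ≠ i`) fixed and only `w_i` random with point masses at
most `p`, if `x̂ⁱ` minimizes `Σ_{j≠i} w_j x_j` over `R`, then the auxiliary loser gap
`Λᵢ = w_i + Σ_{j≠i} w_j x̂ⁱ_j − t` satisfies `Pr(1 ≤ Λᵢ ≤ δ) ≤ δ·p`. -/
theorem per_coordinate_estimate {n : ℕ} (S : Set (Fin n → Bool))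
    (succ : (Fin n → Bool) → (Fin n → Bool) → Prop)
    (hsto : IsStrictTotalOrder (Fin n → Bool) succ)
    (hmono : MonotoneRanking succ)
    (h0 : (fun _ => false) ∉ S)
    (i : Fin n) (t : ℕ) (wfix : Fin n → ℕ)
    (Di : PMF ℕ) (p : ℝ) (hp : 0 ≤ p)
    (hD : ∀ k : ℕ, Di k ≤ ENNReal.ofReal p)
    (δ : ℕ) (xh : Fin n → Bool)
    (hmem : xh ∈ AboveWinnerBar S succ i wfix t)
    (hmin : ∀ y ∈ AboveWinnerBar S succ i wfix t,
      partialDot i wfix xh ≤ partialDot i wfix y) :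
    ∑' v : {v : ℕ | 1 ≤ (v : ℤ) + partialDot i wfix xh - t ∧
        (v : ℤ) + partialDot i wfix xh - t ≤ δ}, Di v ≤ ENNReal.ofReal (δ * p) := by
  set c := partialDot i wfix xh
  have hs : {v : ℕ | 1 ≤ (v : ℤ) + c - t ∧ (v : ℤ) + c - t ≤ δ} ⊆
      (Finset.Ico (t + 1 - c) (t + 1 - c + δ) : Finset ℕ) := by
    intro v hv
    simp only [Set.mem_ofPred_eq] at hv
    rw [Finset.mem_coe, Finset.mem_Ico]
    omega
  refine (ENNReal.tsum_subtype_le_card_mul hs hD).trans_eq ?_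
  rw [Nat.card_Ico, Nat.add_sub_cancel_left, ENNReal.ofReal_mul (Nat.cast_nonneg δ),
    ENNReal.ofReal_natCast]
end

section
/- Let n, k ∈ ℕ with k + 1 ≤ n, and let ε be a real number with 0 < ε ≤ 1. Consider a random graph on the vertex set {1,…,n} in which each of the C(n,2) potential edges e is present independently with probability p_e, where p_e ≥ ε for every potential edge e. Then the probability that the random graph contains no clique on k+1 vertices (i.e., no set T of k+1 vertices with all C(k+1,2) pairs of vertices of T joined by edges) is at most (1 − ε^{C(k+1,2)})^{⌊n/(k+1)⌋}. -/
/-- For independent Bernoulli variables with parameters `p e`, the probability that all variables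
in `U` are true is `∏ e ∈ U, p e`. -/
theorem sum_bernoulli_weight_mul_prod {α : Type*} [Fintype α] [DecidableEq α] (p : α → ℝ)
    (U : Finset α) :
    ∑ G : α → Bool, (∏ e, (if G e then p e else 1 - p e)) *
      ∏ e ∈ U, (if G e then (1 : ℝ) else 0) = ∏ e ∈ U, p e := by
  have hU (g : α → ℝ) : ∏ e ∈ U, g e = ∏ e, if e ∈ U then g e else 1 := by
    rw [Finset.prod_ite_mem, Finset.univ_inter]
  simp_rw [hU, ← Finset.prod_mul_distrib]
  rw [← Fintype.piFinset_univ, ← Finset.prod_univ_sum (fun _ => Finset.univ)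
    (fun e (b : Bool) => (if b then p e else 1 - p e) *
      if e ∈ U then (if b then (1 : ℝ) else 0) else 1)]
  refine Finset.prod_congr rfl fun e _ => ?_
  by_cases he : e ∈ U <;> simp [he]

/-- For independent Bernoulli variables and pairwise disjoint blocks `S b`, also disjoint from `U`,
the probability that all variables in `U` are true while every block contains a false variable. -/
theorem sum_bernoulli_weight_mul_prod_one_sub {α β : Type*} [Fintype α] [DecidableEq α]
    [DecidableEq β] (p : α → ℝ) (S : β → Finset α) (B : Finset β)
    (hS : (B : Set β).PairwiseDisjoint S) (U : Finset α) (hU : ∀ b ∈ B, Disjoint U (S b)) :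
    ∑ G : α → Bool, (∏ e, (if G e then p e else 1 - p e)) *
      ((∏ e ∈ U, (if G e then (1 : ℝ) else 0)) *
        ∏ b ∈ B, (1 - ∏ e ∈ S b, (if G e then (1 : ℝ) else 0))) =
      (∏ e ∈ U, p e) * ∏ b ∈ B, (1 - ∏ e ∈ S b, p e) := by
  induction B using Finset.induction_on generalizing U with
  | empty => simpa using sum_bernoulli_weight_mul_prod p U
  | insert b B hb ih =>
    have hS' : (B : Set β).PairwiseDisjoint S := hS.subset (by simp)
    have hUb : Disjoint U (S b) := hU b (Finset.mem_insert_self b B)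
    have hUB : ∀ c ∈ B, Disjoint U (S c) := fun c hc => hU c (Finset.mem_insert_of_mem hc)
    have hsB : ∀ c ∈ B, Disjoint (U ∪ S b) (S c) := fun c hc =>
      Finset.disjoint_union_left.2 ⟨hUB c hc,
        hS (by simp) (by simp [hc]) (fun h => hb (h ▸ hc))⟩
    have h₁ := ih hS' U hUB
    have h₂ := ih hS' (U ∪ S b) hsB
    simp_rw [Finset.prod_union hUb] at h₂
    simp_rw [Finset.prod_insert hb]
    calc _ = _ - _ := by
          rw [← Finset.sum_sub_distrib]
          exact Finset.sum_congr rfl fun G _ => by ring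
      _ = _ := congrArg₂ (· - ·) h₁ h₂
      _ = _ := by ring

/-- The number of ordered pairs `i < j` inside `T` is at most `T.card.choose 2`. -/
theorem card_filter_pairs_le {V : Type*} [Fintype V] [LinearOrder V] (T : Finset V) :
    (Finset.univ.filter fun e : {e : V × V // e.1 < e.2} => e.1.1 ∈ T ∧ e.1.2 ∈ T).card ≤
      T.card.choose 2 := by
  rw [← Finset.card_powersetCard]
  refine Finset.card_le_card_of_injOn (fun e => {e.1.1, e.1.2}) ?_ ?_
  · rintro ⟨⟨i, j⟩, h⟩ he
    simp only [Finset.coe_filter, Finset.mem_univ, true_and, Set.mem_ofPred_eq] at he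
    simp only [Finset.mem_coe, Finset.mem_powersetCard]
    exact ⟨by simp [Finset.insert_subset_iff, he.1, he.2], Finset.card_pair (ne_of_lt h)⟩
  · rintro ⟨⟨i, j⟩, h⟩ - ⟨⟨i', j'⟩, h'⟩ - heq
    have hs := congrArg (fun s : Finset V => (s : Set V)) heq
    simp only [Finset.coe_insert, Finset.coe_singleton, Set.pair_eq_pair_iff] at hs
    rcases hs with ⟨rfl, rfl⟩ | ⟨rfl, rfl⟩
    · rfl
    · exact absurd h (lt_asymm h')

/-- `Fin n` contains `n / m` pairwise disjoint subsets of size `m`. -/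
theorem exists_pairwise_disjoint_card_eq (n m : ℕ) :
    ∃ T : Fin (n / m) → Finset (Fin n), (∀ b, (T b).card = m) ∧ Pairwise (Function.onFun Disjoint T) := by
  let f : Fin (n / m) × Fin m ↪ Fin n :=
    finProdFinEquiv.toEmbedding.trans (Fin.castLEEmb (Nat.div_mul_le_self n m))
  refine ⟨fun b => Finset.univ.map ((Function.Embedding.sectR b (Fin m)).trans f),
    fun b => by simp, fun b c hbc => ?_⟩
  rw [Function.onFun, Finset.disjoint_left]
  intro x hx hy
  obtain ⟨i, -, rfl⟩ := Finset.mem_map.1 hx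
  obtain ⟨j, -, hj⟩ := Finset.mem_map.1 hy
  exact hbc (congrArg Prod.fst (f.injective hj)).symm

open scoped Classical in
/-- Probabilistic core of the paper's Theorem 11 (`k`-Coloring ∈ SmoothedP): in a random
graph on `n` vertices where each potential edge `e` is present independently with
probability `p e ≥ ε`, the probability that there is no clique on `k+1` vertices is at
most `(1 − ε^{C(k+1,2)})^{⌊n/(k+1)⌋}`. -/
theorem no_clique_prob_le (n k : ℕ) (hkn : k + 1 ≤ n)
    (ε : ℝ) (hε0 : 0 < ε) (hε1 : ε ≤ 1)
    (p : {e : Fin n × Fin n // e.1 < e.2} → ℝ)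
    (hpl : ∀ e, ε ≤ p e) (hpu : ∀ e, p e ≤ 1) :
    ∑ G : {e : Fin n × Fin n // e.1 < e.2} → Bool,
      (if ¬∃ T : Finset (Fin n), T.card = k + 1 ∧
            ∀ i ∈ T, ∀ j ∈ T, ∀ h : i < j, G ⟨(i, j), h⟩ = true
        then ∏ e, (if G e then p e else 1 - p e) else 0)
      ≤ (1 - ε ^ Nat.choose (k + 1) 2) ^ (n / (k + 1)) := by
  obtain ⟨T, hTcard, hTdisj⟩ := exists_pairwise_disjoint_card_eq n (k + 1)
  let S : Fin (n / (k + 1)) → Finset {e : Fin n × Fin n // e.1 < e.2} := fun b =>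
    Finset.univ.filter fun e => e.1.1 ∈ T b ∧ e.1.2 ∈ T b
  have hS : ((Finset.univ : Finset (Fin (n / (k + 1)))) : Set _).PairwiseDisjoint S := by
    intro b _ c _ hbc
    rw [Function.onFun, Finset.disjoint_left]
    intro e heb hec
    exact Finset.disjoint_left.1 (hTdisj hbc) (Finset.mem_filter.1 heb).2.1
      (Finset.mem_filter.1 hec).2.1
  have hp0 : ∀ e, 0 ≤ p e := fun e => hε0.le.trans (hpl e)
  calc
    _ ≤ ∑ G : {e : Fin n × Fin n // e.1 < e.2} → Bool,
        (∏ e, (if G e then p e else 1 - p e)) *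
          ((∏ e ∈ (∅ : Finset {e : Fin n × Fin n // e.1 < e.2}),
              (if G e then (1 : ℝ) else 0)) *
            ∏ b, (1 - ∏ e ∈ S b, (if G e then (1 : ℝ) else 0))) := by
      refine Finset.sum_le_sum fun G _ => ?_
      rw [Finset.prod_empty, one_mul]
      split_ifs with hG
      · refine mul_nonneg (Finset.prod_nonneg fun e _ => ?_) (Finset.prod_nonneg fun b _ => ?_)
        · split_ifs
          exacts [hp0 e, sub_nonneg.2 (hpu e)]
        · exact sub_nonneg.2 (Finset.prod_le_one (fun e _ => by split_ifs <;> norm_num)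
            fun e _ => by split_ifs <;> norm_num)
      · rw [Finset.prod_eq_one (s := Finset.univ) (f := fun b => 1 - _), mul_one]
        intro b _
        by_contra hb
        refine hG ⟨T b, hTcard b, fun i hi j hj h => ?_⟩
        by_contra hij
        refine hb ?_
        rw [Finset.prod_eq_zero (i := ⟨(i, j), h⟩) (by simp [S, hi, hj]) (if_neg hij), sub_zero]
    _ = ∏ b, (1 - ∏ e ∈ S b, p e) := by
      rw [sum_bernoulli_weight_mul_prod_one_sub p S Finset.univ hS ∅ (by simp),
        Finset.prod_empty, one_mul]
    _ ≤ ∏ _b : Fin (n / (k + 1)), (1 - ε ^ Nat.choose (k + 1) 2) := by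
      refine Finset.prod_le_prod
        (fun b _ => sub_nonneg.2 (Finset.prod_le_one (fun e _ => hp0 e) fun e _ => hpu e))
        fun b _ => sub_le_sub_left ?_ 1
      calc ε ^ Nat.choose (k + 1) 2 ≤ ε ^ (S b).card :=
            pow_le_pow_of_le_one hε0.le hε1 (hTcard b ▸ card_filter_pairs_le (T b))
        _ = ∏ _e ∈ S b, ε := (Finset.prod_const ε).symm
        _ ≤ ∏ e ∈ S b, p e := Finset.prod_le_prod (fun _ _ => hε0.le) fun e _ => hpl e
    _ = _ := by simp
end
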